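/- arXiv:2504.17514 — 7 statements merged into one kernel-verified Lean document; each statement's English description precedes it below -/
import Mathlib

section
/- Let F be a finite field with q elements, let s ≥ 1, ℓ ≥ 1 be integers and z_1, …, z_s ∈ ℕ, and set N = Σ_{i=1}^s (ℓ + z_i). Let T be the N × ℓ matrix over F obtained by stacking vertically the blocks T^{(i)} = [I_ℓ ; 0_{z_i × ℓ}] (the ℓ × ℓ identity on top of a z_i × ℓ zero block), for i = 1, …, s. Let G be an arbitrary N × w matrix over F. Let X = ((M_1, K_1), (M_2, K_2), …, (M_s, K_s)) be a random row N-vector distributed uniformly on F^N (equivalently, M_1, …, M_s are uniform on F^ℓ, K_i is uniform on F^{z_i}, and all of them are mutually independent), so that X·T = Σ_{i=1}^s M_i ∈ F^ℓ. Then the random vectors X·G ∈ F^w and X·T are independent (with respect to the uniform probability measure on F^N) if and only if the column space of G and the column space of T intersect trivially, i.e. ⟨G⟩ ∩ ⟨T⟩ = {0}. -/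
noncomputable section

/-- Every type is endowed with the `⊤` σ-algebra (every set measurable), the usual choice
for finite sample spaces. -/
local instance (priority := high) topMeasurableSpace (α : Type _) : MeasurableSpace α := ⊤

open ProbabilityTheory

theorem toMeasure_uniformOfFintype_inter_of_equiv {Ω : Type*} [Fintype Ω] [Nonempty Ω]
    {A B : Set Ω} (e : Ω × Ω ≃ Ω × Ω)
    (he : ∀ p : Ω × Ω, p.1 ∈ A ∧ p.2 ∈ B ↔ (e p).1 ∈ A ∩ B) :
    (PMF.uniformOfFintype Ω).toMeasure (A ∩ B) =
      (PMF.uniformOfFintype Ω).toMeasure A * (PMF.uniformOfFintype Ω).toMeasure B := by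
  classical
  have hcard : Fintype.card A * Fintype.card B =
      Fintype.card (A ∩ B : Set Ω) * Fintype.card Ω := by
    have hequiv : (A ×ˢ B : Set (Ω × Ω)) ≃ ((A ∩ B) ×ˢ Set.univ : Set (Ω × Ω)) :=
      e.subtypeEquiv fun p => by
        simpa only [Set.mem_prod, Set.mem_univ, and_true] using he p
    have h := Nat.card_congr hequiv
    rwa [Nat.card_coe_set_eq, Nat.card_coe_set_eq, Set.ncard_prod, Set.ncard_prod,
      Set.ncard_univ, Nat.card_eq_fintype_card, ← Nat.card_coe_set_eq, ← Nat.card_coe_set_eq,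
      ← Nat.card_coe_set_eq, Nat.card_eq_fintype_card, Nat.card_eq_fintype_card,
      Nat.card_eq_fintype_card] at h
  have hΩ : (Fintype.card Ω : ENNReal) ≠ 0 := by simp
  have hΩ' : (Fintype.card Ω : ENNReal) ≠ ⊤ := ENNReal.natCast_ne_top _
  rw [PMF.toMeasure_uniformOfFintype_apply _ trivial,
    PMF.toMeasure_uniformOfFintype_apply _ trivial,
    PMF.toMeasure_uniformOfFintype_apply _ trivial, div_eq_mul_inv, div_eq_mul_inv,
    div_eq_mul_inv, mul_mul_mul_comm, ← Nat.cast_mul, hcard, Nat.cast_mul, mul_assoc,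
    ← mul_assoc (Fintype.card Ω : ENNReal), ENNReal.mul_inv_cancel hΩ hΩ', one_mul]

/-- An idempotent additive map exchanges the complementary components of a pair of vectors. -/
def exchangeEquiv {V : Type*} [AddCommGroup V] (P : V →+ V) (hP : ∀ x, P (P x) = P x) :
    V × V ≃ V × V :=
  Function.Involutive.toPerm (fun p => (P p.1 + (p.2 - P p.2), P p.2 + (p.1 - P p.1))) fun p => by
    ext <;> simp [hP]

theorem exists_matrix_idempotent_of_disjoint_range {F ι m n : Type*} [Field F] [Fintype ι]
    [Fintype m] [Fintype n] {G : Matrix ι m F} {T : Matrix ι n F}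
    (h : Disjoint (LinearMap.range G.mulVecLin) (LinearMap.range T.mulVecLin)) :
    ∃ Q : Matrix ι ι F, Q * Q = Q ∧ Q * G = G ∧ Q * T = 0 := by
  classical
  obtain ⟨C, hTC, hC⟩ := h.symm.exists_isCompl
  let p := (LinearMap.range G.mulVecLin).projection C hC.symm
  refine ⟨LinearMap.toMatrix' p, ?_, ?_, ?_⟩ <;> apply Matrix.toLin'.injective <;>
    refine LinearMap.ext fun v => ?_ <;>
    simp only [Matrix.toLin'_mul, Matrix.toLin'_toMatrix', LinearMap.comp_apply, map_zero,
      LinearMap.zero_apply]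
  · exact Submodule.projection_apply_of_mem_left _ (Submodule.projection_apply_mem _ _)
  · exact Submodule.projection_apply_of_mem_left _ ⟨v, rfl⟩
  · exact Submodule.projection_apply_of_mem_right _ (hTC ⟨v, rfl⟩)

theorem indepFun_vecMul_of_disjoint_range {F ι m n : Type*} [Field F] [Fintype F] [Fintype ι]
    [DecidableEq ι] [Fintype m] [Fintype n] {G : Matrix ι m F} {T : Matrix ι n F}
    (h : Disjoint (LinearMap.range G.mulVecLin) (LinearMap.range T.mulVecLin)) :
    IndepFun (fun x : ι → F => Matrix.vecMul x G) (fun x : ι → F => Matrix.vecMul x T)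
      (PMF.uniformOfFintype (ι → F)).toMeasure := by
  obtain ⟨Q, hQ, hG, hT⟩ := exists_matrix_idempotent_of_disjoint_range h
  rw [indepFun_iff_measure_inter_preimage_eq_mul]
  intro s t _ _
  refine toMeasure_uniformOfFintype_inter_of_equiv
    (exchangeEquiv Q.vecMulLinear.toAddMonoidHom fun x => by simp [hQ]) fun p => ?_
  simp [exchangeEquiv, Matrix.add_vecMul, Matrix.sub_vecMul, hG, hT]

theorem disjoint_range_of_indepFun_vecMul {F ι m n : Type*} [Field F] [Fintype F] [Fintype ι]
    [DecidableEq ι] [Fintype m] [Fintype n] {G : Matrix ι m F} {T : Matrix ι n F}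
    (h : IndepFun (fun x : ι → F => Matrix.vecMul x G) (fun x : ι → F => Matrix.vecMul x T)
      (PMF.uniformOfFintype (ι → F)).toMeasure) :
    Disjoint (LinearMap.range G.mulVecLin) (LinearMap.range T.mulVecLin) := by
  classical
  rw [Submodule.disjoint_def]
  rintro c ⟨a, ha⟩ ⟨b, hb⟩
  rw [Matrix.mulVecLin_apply] at ha hb
  have hinter := indepFun_iff_measure_inter_preimage_eq_mul.mp h
    {u | u ⬝ᵥ a = 0} {u | u ⬝ᵥ b = 0} trivial trivial
  simp only [Set.preimage_ofPred_eq, ← Matrix.dotProduct_mulVec, ha, hb, Set.inter_self] at hinter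
  set μ := (PMF.uniformOfFintype (ι → F)).toMeasure
  set S : Set (ι → F) := {x | x ⬝ᵥ c = 0}
  have hS : μ S ≠ 0 := by
    rw [Ne, PMF.toMeasure_apply_eq_zero_iff _ trivial, PMF.support_uniformOfFintype]
    exact fun hd => Set.disjoint_left.mp hd (Set.mem_univ 0) (zero_dotProduct c)
  have hS1 : μ S = 1 :=
    (ENNReal.mul_eq_left hS (MeasureTheory.measure_ne_top μ S)).mp hinter.symm
  rw [PMF.toMeasure_apply_eq_one_iff _ trivial, PMF.support_uniformOfFintype] at hS1
  exact dotProduct_eq_zero_iff.mp fun x => (dotProduct_comm c x).trans (hS1 (Set.mem_univ x))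

/-- Theorem 4: algebraic characterization of target-function security. Let `N = Σ_i (ℓ + z_i)`
and let `T` be the vertical stack of the blocks `[I_ℓ ; 0_{z_i × ℓ}]`. For `X` uniform on
`F^N` (so that `X·T = Σ_i M_i`), the random vectors `X·G` and `X·T` are independent with
respect to the uniform measure iff the column spaces of `G` and `T` intersect trivially. -/
theorem indep_iff_trivial_inter
    {F : Type} [Field F] [Fintype F] [DecidableEq F]
    (q s l : ℕ) (hq : Fintype.card F = q) (hs : 1 ≤ s) (hl : 1 ≤ l)
    (z : Fin s → ℕ) (w : ℕ)
    (T : Matrix ((i : Fin s) × Fin (l + z i)) (Fin l) F)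
    (hT : ∀ p j, T p j = if (p.2 : ℕ) = (j : ℕ) then (1 : F) else 0)
    (G : Matrix ((i : Fin s) × Fin (l + z i)) (Fin w) F) :
    IndepFun (fun x : ((i : Fin s) × Fin (l + z i)) → F => Matrix.vecMul x G)
      (fun x : ((i : Fin s) × Fin (l + z i)) → F => Matrix.vecMul x T)
      (PMF.uniformOfFintype (((i : Fin s) × Fin (l + z i)) → F)).toMeasure ↔
    LinearMap.range G.mulVecLin ⊓ LinearMap.range T.mulVecLin = ⊥ := by
  rw [← disjoint_iff]
  exact ⟨disjoint_range_of_indepFun_vecMul, indepFun_vecMul_of_disjoint_range⟩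

end
end

section
/- In a network, for every security level r ∈ ℕ, the minimum of |C| − |W| over all valid pairs (C, W) ∈ Λ × 𝒲_r is at least the minimum of |C| − |W| over all pairs (C, W) ∈ Λ × 𝒲_r with W ⊆ C and D_W ⊆ I_C (both minima taken in ℕ ∪ {∞}, the infimum of an empty set being ∞). Equivalently: for every valid pair (C, W) there exists a pair (C′, W′) with C′ ∈ Λ, W′ ⊆ C′, |W′| ≤ r, D_{W′} ⊆ I_{C′} and |C′| − |W′| ≤ |C| − |W|. -/
/-- A (directed) path starting at the node `u` and ending at the edge `e`. -/
def IsPathToEdge {V E : Type} (tail head : E → V) (u : V) (p : List E) (e : E) : Prop :=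
  (∃ d, p.head? = some d ∧ tail d = u) ∧
    List.Chain' (fun d e' => head d = tail e') p ∧ p.getLast? = some e

/-- A (directed) path from the node `u` to the node `v`. -/
def IsPathToNode {V E : Type} (tail head : E → V) (u : V) (p : List E) (v : V) : Prop :=
  (∃ d, p.head? = some d ∧ tail d = u) ∧
    List.Chain' (fun d e' => head d = tail e') p ∧
    (∃ d, p.getLast? = some d ∧ head d = v)

/-- `D_C`: the set of source nodes from which some edge of `C` can be reached. -/
def Dset {V E : Type} (tail head : E → V) (S : Set V) (C : Set E) : Set V :=
  {σ | σ ∈ S ∧ ∃ e ∈ C, ∃ p : List E, IsPathToEdge tail head σ p e}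

/-- `I_C`: the set of source nodes `σ` such that every path from `σ` to the sink `ρ`
contains an edge of `C`. -/
def Iset {V E : Type} (tail head : E → V) (S : Set V) (ρ : V) (C : Set E) : Set V :=
  {σ | σ ∈ S ∧ ∀ p : List E, IsPathToNode tail head σ p ρ → ∃ e ∈ p, e ∈ C}

/-- A pair `(C, W) ∈ Λ × 𝒲_r` is valid: `C` is a cut set (`I_C ≠ ∅`), `W ⊆ C`, `|W| ≤ r`,
and either `I_C \ D_W ≠ ∅` or `D_W = I_C = S`. -/
def ValidPair {V E : Type} [Fintype E] (tail head : E → V) (S : Set V) (ρ : V)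
    (r : ℕ) (C W : Finset E) : Prop :=
  (Iset tail head S ρ ↑C).Nonempty ∧ W ⊆ C ∧ W.card ≤ r ∧
    ((Iset tail head S ρ ↑C \ Dset tail head S ↑W).Nonempty ∨
      (Dset tail head S ↑W = S ∧ Iset tail head S ρ ↑C = S))

/-- Truncating a path to a node at one of its edges gives a path to that edge. -/
theorem IsPathToNode.exists_isPathToEdge {V E : Type} {tail head : E → V} {u v : V}
    {p : List E} (hp : IsPathToNode tail head u p v) {e : E} (he : e ∈ p) :
    ∃ q : List E, IsPathToEdge tail head u q e := by
  obtain ⟨⟨d, hd, hdu⟩, hchain, -⟩ := hp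
  obtain ⟨l, t, rfl⟩ := List.append_of_mem he
  refine ⟨l ++ [e], ⟨d, ?_, hdu⟩, ?_, by simp⟩
  · cases l <;> simpa using hd
  · exact hchain.prefix ⟨t, by simp⟩

/-- Removing from `C` a set of edges not reachable from `σ` keeps `σ` separated from the sink. -/
theorem mem_Iset_sdiff {V E : Type} {tail head : E → V} {S : Set V} {ρ σ : V} {C W : Set E}
    (hC : σ ∈ Iset tail head S ρ C) (hW : σ ∉ Dset tail head S W) :
    σ ∈ Iset tail head S ρ (C \ W) := by
  refine ⟨hC.1, fun p hp => ?_⟩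
  obtain ⟨e, hep, heC⟩ := hC.2 p hp
  exact ⟨e, hep, heC, fun heW => hW ⟨hC.1, e, heW, hp.exists_isPathToEdge hep⟩⟩

/-- For every security level `r` and every valid pair `(C, W) ∈ Λ × 𝒲_r`, there is a pair
`(C', W') ∈ Λ × 𝒲_r` with `W' ⊆ C'`, `D_{W'} ⊆ I_{C'}` and `|C'| − |W'| ≤ |C| − |W|`; hence
the minimum of `|C| − |W|` over valid pairs is at least the corresponding minimum over pairs
with `W ⊆ C` and `D_W ⊆ I_C`. -/
theorem valid_pair_ge_source_pair
    {V E : Type} [Fintype V] [Fintype E] (tail head : E → V)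
    (S : Set V) (ρ : V) (hρ : ρ ∉ S) (r : ℕ) (C W : Finset E)
    (h : ValidPair tail head S ρ r C W) :
    ∃ C' W' : Finset E, (Iset tail head S ρ ↑C').Nonempty ∧ W' ⊆ C' ∧ W'.card ≤ r ∧
      Dset tail head S ↑W' ⊆ Iset tail head S ρ ↑C' ∧
      C'.card - W'.card ≤ C.card - W.card := by
  classical
  obtain ⟨hne, hWC, hWr, ⟨σ, hσC, hσW⟩ | ⟨hD, hI⟩⟩ := h
  · refine ⟨C \ W, ∅, ⟨σ, ?_⟩, Finset.empty_subset _, by simp, ?_, ?_⟩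
    · rw [Finset.coe_sdiff]
      exact mem_Iset_sdiff hσC hσW
    · rintro τ ⟨-, e, he, -⟩
      simp at he
    · simp [Finset.card_sdiff_of_subset hWC]
  · exact ⟨C, W, hne, hWC, hWr, by rw [hD, hI], le_rfl⟩
end

section
/- In a network with s ≥ 1 source nodes, each of which has a path to the sink ρ, let r ∈ ℕ be a security level and let m* denote the minimum of |C| − |W| over all valid pairs (C, W) ∈ Λ × 𝒲_r (this set of valid pairs is nonempty). Then: (i) C_min ≤ m* + r; (ii) m* ≤ C_min; and (iii) if r ≤ C_min^S, then m* + r ≤ C_min^S. In particular, when r ≤ C_min^S one has C_min − r ≤ m* ≤ min{C_min, C_min^S − r}. -/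
/-- `C_min^S = min{|C| : I_C = S}`, the minimum cut capacity separating `ρ` from `S`. -/
noncomputable def CminS {V E : Type} [Fintype E] (tail head : E → V)
    (S : Set V) (ρ : V) : ℕ :=
  sInf {n | ∃ C : Finset E, Iset tail head S ρ ↑C = S ∧ C.card = n}


/-- `mincut(σ, ρ) = min{|C| : σ ∈ I_C}`. -/
noncomputable def mincutNode {V E : Type} [Fintype E] (tail head : E → V)
    (S : Set V) (ρ : V) (σ : V) : ℕ :=
  sInf {n | ∃ C : Finset E, σ ∈ Iset tail head S ρ ↑C ∧ C.card = n}

/-- `C_min = min_{σ ∈ S} mincut(σ, ρ)`. -/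
noncomputable def Cmin {V E : Type} [Fintype E] (tail head : E → V)
    (S : Set V) (ρ : V) : ℕ :=
  sInf {n | ∃ σ ∈ S, n = mincutNode tail head S ρ σ}

theorem Dset_subset {V E : Type} (tail head : E → V) (S : Set V) (C : Set E) :
    Dset tail head S C ⊆ S := fun _ h => h.1

theorem Dset_empty {V E : Type} (tail head : E → V) (S : Set V) :
    Dset tail head S ∅ = ∅ := by
  simp [Dset]

theorem Iset_subset {V E : Type} (tail head : E → V) (S : Set V) (ρ : V) (C : Set E) :
    Iset tail head S ρ C ⊆ S := fun _ h => h.1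

theorem Iset_univ {V E : Type} (tail head : E → V) (S : Set V) (ρ : V) :
    Iset tail head S ρ Set.univ = S := by
  refine (Iset_subset tail head S ρ _).antisymm fun σ hσ => ⟨hσ, fun p hp => ?_⟩
  obtain ⟨⟨d, hd, -⟩, -⟩ := hp
  exact ⟨d, List.mem_of_head? hd, Set.mem_univ d⟩

theorem exists_card_eq_CminS {V E : Type} [Fintype E] (tail head : E → V) (S : Set V) (ρ : V) :
    ∃ C : Finset E, Iset tail head S ρ ↑C = S ∧ C.card = CminS tail head S ρ :=
  Nat.sInf_mem (s := {n | ∃ C : Finset E, Iset tail head S ρ ↑C = S ∧ C.card = n})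
    ⟨_, Finset.univ, by rw [Finset.coe_univ, Iset_univ], rfl⟩

theorem exists_card_eq_mincutNode {V E : Type} [Fintype E] (tail head : E → V) (S : Set V)
    (ρ : V) {σ : V} (hσ : σ ∈ S) :
    ∃ C : Finset E, σ ∈ Iset tail head S ρ ↑C ∧ C.card = mincutNode tail head S ρ σ :=
  Nat.sInf_mem (s := {n | ∃ C : Finset E, σ ∈ Iset tail head S ρ ↑C ∧ C.card = n})
    ⟨_, Finset.univ, by rwa [Finset.coe_univ, Iset_univ], rfl⟩

theorem exists_card_eq_Cmin {V E : Type} [Fintype E] (tail head : E → V) {S : Set V} (ρ : V)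
    (hS : S.Nonempty) :
    ∃ C : Finset E, (Iset tail head S ρ ↑C).Nonempty ∧ C.card = Cmin tail head S ρ := by
  obtain ⟨σ, hσ, h⟩ : ∃ σ ∈ S, Cmin tail head S ρ = mincutNode tail head S ρ σ :=
    Nat.sInf_mem (s := {n | ∃ σ ∈ S, n = mincutNode tail head S ρ σ})
      (hS.imp' _ fun σ hσ => ⟨σ, hσ, rfl⟩)
  obtain ⟨C, hC, hcard⟩ := exists_card_eq_mincutNode tail head S ρ hσ
  exact ⟨C, ⟨σ, hC⟩, hcard.trans h.symm⟩

theorem Cmin_le_card {V E : Type} [Fintype E] (tail head : E → V) (S : Set V) (ρ : V)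
    {C : Finset E} (hC : (Iset tail head S ρ ↑C).Nonempty) :
    Cmin tail head S ρ ≤ C.card := by
  obtain ⟨σ, hσ⟩ := hC
  calc Cmin tail head S ρ ≤ mincutNode tail head S ρ σ := Nat.sInf_le ⟨σ, hσ.1, rfl⟩
    _ ≤ C.card := Nat.sInf_le ⟨C, hσ, rfl⟩

theorem validPair_empty {V E : Type} [Fintype E] (tail head : E → V) (S : Set V) (ρ : V)
    (r : ℕ) {C : Finset E} (hC : (Iset tail head S ρ ↑C).Nonempty) :
    ValidPair tail head S ρ r C ∅ :=
  ⟨hC, C.empty_subset, Nat.zero_le r, Or.inl (by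
    rwa [Finset.coe_empty, Dset_empty, Set.sdiff_empty])⟩

/-- If `C` separates every source from the sink, each `W ⊆ C` with `|W| ≤ r` gives a
valid pair. -/
theorem validPair_of_Iset_eq {V E : Type} [Fintype E] (tail head : E → V) {S : Set V} (ρ : V)
    {r : ℕ} (hS : S.Nonempty) {C W : Finset E} (hC : Iset tail head S ρ ↑C = S)
    (hWC : W ⊆ C) (hW : W.card ≤ r) : ValidPair tail head S ρ r C W := by
  refine ⟨by rwa [hC], hWC, hW, ?_⟩
  rw [hC]
  by_cases h : S ⊆ Dset tail head S ↑W
  · exact Or.inr ⟨(Dset_subset tail head S _).antisymm h, rfl⟩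
  · exact Or.inl (Set.sdiff_nonempty.mpr h)

/-- Corollary 2 (second part): if `m*` is the minimum of `|C| − |W|` over valid pairs
`(C, W) ∈ Λ × 𝒲_r`, then (i) `C_min ≤ m* + r`, (ii) `m* ≤ C_min`, and (iii) if
`r ≤ C_min^S` then `m* + r ≤ C_min^S`; i.e. for `r ≤ C_min^S`,
`C_min − r ≤ m* ≤ min{C_min, C_min^S − r}`. -/
theorem bounds_on_min_valid_pair
    {V E : Type} [Fintype V] [Fintype E] (tail head : E → V)
    (S : Set V) (ρ : V) (hρ : ρ ∉ S) (hS : S.Nonempty)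
    (hpath : ∀ σ ∈ S, ∃ p : List E, IsPathToNode tail head σ p ρ)
    (r : ℕ) (mstar : ℕ)
    (hattain : ∃ C W : Finset E, ValidPair tail head S ρ r C W ∧ mstar = C.card - W.card)
    (hmin : ∀ C W : Finset E, ValidPair tail head S ρ r C W → mstar ≤ C.card - W.card) :
    Cmin tail head S ρ ≤ mstar + r ∧
    mstar ≤ Cmin tail head S ρ ∧
    (r ≤ CminS tail head S ρ → mstar + r ≤ CminS tail head S ρ) := by
  refine ⟨?_, ?_, fun hr => ?_⟩
  · obtain ⟨C, W, ⟨hI, hWC, hW, -⟩, rfl⟩ := hattain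
    have := Cmin_le_card tail head S ρ hI
    omega
  · obtain ⟨C, hC, hcard⟩ := exists_card_eq_Cmin tail head ρ hS
    simpa [hcard] using hmin C ∅ (validPair_empty tail head S ρ r hC)
  · obtain ⟨C, hC, hcard⟩ := exists_card_eq_CminS tail head S ρ
    obtain ⟨W, hWC, hW⟩ := Finset.exists_subset_card_eq (hcard.symm ▸ hr)
    have := hmin C W (validPair_of_Iset_eq tail head ρ hS hC hWC hW.le)
    omega
end

section
/- In a network with s ≥ 1 source nodes, each of which has a path to the sink ρ, if the security level r ∈ ℕ satisfies C_min^S ≤ r, then the minimum of |C| − |W| over all valid pairs (C, W) ∈ Λ × 𝒲_r equals 0. -/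
/-- If every source has a path to the sink, then `I_C ⊆ D_C`. -/
theorem Iset_subset_Dset {V E : Type} {tail head : E → V} {S : Set V} {ρ : V}
    (hpath : ∀ σ ∈ S, ∃ p : List E, IsPathToNode tail head σ p ρ) (C : Set E) :
    Iset tail head S ρ C ⊆ Dset tail head S C := by
  rintro σ ⟨hσ, hcut⟩
  obtain ⟨p, hp⟩ := hpath σ hσ
  obtain ⟨e, hep, heC⟩ := hcut p hp
  exact ⟨hσ, e, heC, hp.exists_isPathToEdge hep⟩

/-- If each source node has a path to the sink and `C_min^S ≤ r`, then the minimum of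
`|C| − |W|` over all valid pairs `(C, W) ∈ Λ × 𝒲_r` equals `0`. -/
theorem min_valid_pair_eq_zero_of_CminS_le
    {V E : Type} [Fintype V] [Fintype E] (tail head : E → V)
    (S : Set V) (ρ : V) (hρ : ρ ∉ S) (hS : S.Nonempty)
    (hpath : ∀ σ ∈ S, ∃ p : List E, IsPathToNode tail head σ p ρ)
    (r : ℕ) (hr : CminS tail head S ρ ≤ r) :
    {n | ∃ C W : Finset E, ValidPair tail head S ρ r C W ∧ n = C.card - W.card}.Nonempty ∧
    sInf {n | ∃ C W : Finset E, ValidPair tail head S ρ r C W ∧ n = C.card - W.card} = 0 := by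
  obtain ⟨C, hC, hcard⟩ := exists_card_eq_CminS tail head S ρ
  have hD : Dset tail head S ↑C = S :=
    Set.Subset.antisymm (fun σ h => h.1) (hC.symm.subset.trans (Iset_subset_Dset hpath ↑C))
  have hmem : 0 ∈ {n | ∃ C W : Finset E,
      ValidPair tail head S ρ r C W ∧ n = C.card - W.card} :=
    ⟨C, C, ⟨hC.symm ▸ hS, Finset.Subset.refl C, hcard.trans_le hr, Or.inr ⟨hD, hC⟩⟩,
      (Nat.sub_self _).symm⟩
  exact ⟨⟨0, hmem⟩, Nat.sInf_eq_zero.mpr (Or.inl hmem)⟩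
end

section
/- Let F be a finite field with q elements, let s ≥ 1 and 0 ≤ r ≤ R be integers with R ≥ 1. Identify F^{Rs} with (F^R)^s, writing each vector v ∈ F^{Rs} in blocks v = (v^{(1)}, …, v^{(s)}) with v^{(i)} ∈ F^R. Let (U_t)_{t∈T} be a finite family of m subspaces of F^{Rs}, each of dimension at most r, and let V ⊆ F^{Rs} be a subspace containing the diagonal Δ = {(v, v, …, v) : v ∈ F^R}. If q > m + s, then there exist vectors b_1, …, b_{R−r} ∈ V such that: (i) span{b_1, …, b_{R−r}} ∩ U_t = {0} for every t ∈ T; and (ii) for each 1 ≤ i ≤ s, the block components b_1^{(i)}, …, b_{R−r}^{(i)} ∈ F^R are linearly independent. -/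
/-- Over a finite field, fewer than `|F|` proper subspaces do not cover a finite vector space. -/
theorem Submodule.exists_forall_notMem_of_card_lt {F E ι : Type*} [Field F] [Fintype F]
    [AddCommGroup E] [Module F E] [FiniteDimensional F E] [Fintype ι]
    (p : ι → Submodule F E) (hp : ∀ i, p i ≠ ⊤) (hι : Fintype.card ι < Fintype.card F) :
    ∃ x, ∀ i, x ∉ p i := by
  classical
  by_contra! hcover
  have : Finite E := Module.finite_of_finite F
  have := Fintype.ofFinite E
  have hcard (i : ι) : Nat.card F * Nat.card (p i) ≤ Nat.card E := by
    rw [Module.natCard_eq_pow_finrank (K := F) (V := p i),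
      Module.natCard_eq_pow_finrank (K := F) (V := E), ← pow_succ']
    exact Nat.pow_le_pow_right Nat.card_pos (Submodule.finrank_lt (hp i))
  have hunion : Nat.card E ≤ ∑ i, Nat.card (p i) := by
    have hsub : (Finset.univ : Finset E) ⊆
        Finset.univ.biUnion fun i => Finset.univ.filter (· ∈ p i) := by
      intro x _
      simpa using hcover x
    have h := (Finset.card_le_card hsub).trans Finset.card_biUnion_le
    simpa [Nat.card_eq_fintype_card, Fintype.card_subtype] using h
  have hmul : Nat.card F * Nat.card E ≤ Fintype.card ι * Nat.card E :=
    calc Nat.card F * Nat.card E ≤ ∑ i, Nat.card F * Nat.card (p i) := by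
          rw [← Finset.mul_sum]
          exact Nat.mul_le_mul_left _ hunion
      _ ≤ ∑ _i : ι, Nat.card E := Finset.sum_le_sum fun i _ => hcard i
      _ = Fintype.card ι * Nat.card E := by simp
  have h := Nat.le_of_mul_le_mul_right hmul Nat.card_pos
  rw [Nat.card_eq_fintype_card] at h
  omega

/-- Fewer than `|F|` subspaces of codimension at least `n` have a common `n`-tuple of vectors
which is linearly independent modulo each of them. -/
theorem Submodule.exists_forall_linearIndependent_mkQ_comp {F E κ : Type*}
    [Field F] [Fintype F] [AddCommGroup E] [Module F E] [FiniteDimensional F E] [Fintype κ]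
    (K : κ → Submodule F E) (hκ : Fintype.card κ < Fintype.card F) (n : ℕ)
    (hn : ∀ c, n ≤ Module.finrank F (E ⧸ K c)) :
    ∃ b : Fin n → E, ∀ c, LinearIndependent F ((K c).mkQ ∘ b) := by
  induction n with
  | zero => exact ⟨Fin.elim0, fun c => linearIndependent_empty_type⟩
  | succ n ih =>
    obtain ⟨b, hb⟩ := ih fun c => (Nat.le_succ n).trans (hn c)
    obtain ⟨x, hx⟩ := Submodule.exists_forall_notMem_of_card_lt
      (fun c => (Submodule.span F (Set.range ((K c).mkQ ∘ b))).comap (K c).mkQ)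
      (fun c htop => by
        have hspan : Submodule.span F (Set.range ((K c).mkQ ∘ b)) = ⊤ := by
          rw [eq_top_iff, ← (K c).range_mkQ]
          exact LinearMap.range_le_iff_comap.mpr htop
        have hle := finrank_range_le_card (R := F) ((K c).mkQ ∘ b)
        rw [Set.finrank, hspan, finrank_top, Fintype.card_fin] at hle
        have := hn c
        omega) hκ
    refine ⟨Fin.cons x b, fun c => ?_⟩
    rw [Fin.comp_cons, linearIndependent_finCons]
    exact ⟨hb c, hx c⟩

/-- Existence result of Section V-B: given a family of `m` subspaces of `F^{Rs} = (F^R)^s`,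
each of dimension at most `r`, and a subspace `V` containing the diagonal
`Δ = {(v, …, v) : v ∈ F^R}`, if `q > m + s` then there exist `b_1, …, b_{R−r} ∈ V` whose
span meets every subspace of the family trivially and whose `i`-th block components are
linearly independent for each `1 ≤ i ≤ s`. -/
theorem exists_b_vectors
    {F : Type} [Field F] [Fintype F] [DecidableEq F] (q s R r m : ℕ)
    (hq : Fintype.card F = q) (hs : 1 ≤ s) (hR : 1 ≤ R) (hr : r ≤ R)
    {ι : Type} [Fintype ι] (hm : Fintype.card ι = m)
    (U : ι → Submodule F (Fin s → Fin R → F))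
    (hU : ∀ t, Module.finrank F (U t) ≤ r)
    (V : Submodule F (Fin s → Fin R → F))
    (hV : ∀ v : Fin R → F, (fun _ => v) ∈ V)
    (hq2 : m + s < q) :
    ∃ b : Fin (R - r) → (Fin s → Fin R → F),
      (∀ j, b j ∈ V) ∧
      (∀ t, Submodule.span F (Set.range b) ⊓ U t = ⊥) ∧
      (∀ i : Fin s, LinearIndependent F (fun j => b j i)) := by
  have hrank : R ≤ Module.finrank F V := by
    let diag : (Fin R → F) →ₗ[F] V :=
      { toFun := fun v => ⟨fun _ => v, hV v⟩
        map_add' := fun _ _ => rfl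
        map_smul' := fun _ _ => rfl }
    have hinj : Function.Injective diag := fun v w h =>
      congrFun (congrArg Subtype.val h) ⟨0, hs⟩
    simpa using LinearMap.finrank_le_finrank_of_injective hinj
  let π (i : Fin s) : V →ₗ[F] Fin R → F := LinearMap.proj i ∘ₗ V.subtype
  have hU' (t : ι) : R - r ≤ Module.finrank F (V ⧸ (U t).comap V.subtype) := by
    have hle : Module.finrank F ((U t).comap V.subtype) ≤ r := by
      refine le_trans ?_ (hU t)
      rw [← Submodule.finrank_map_subtype_eq, Submodule.map_comap_subtype]
      exact Submodule.finrank_mono inf_le_right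
    have := Submodule.finrank_quotient_add_finrank ((U t).comap V.subtype)
    omega
  have hπ (i : Fin s) : R - r ≤ Module.finrank F (V ⧸ LinearMap.ker (π i)) := by
    have htop : LinearMap.range (π i) = ⊤ :=
      LinearMap.range_eq_top.mpr fun v => ⟨⟨fun _ => v, hV v⟩, rfl⟩
    rw [(π i).quotKerEquivRange.finrank_eq, htop]
    simp
  obtain ⟨b, hb⟩ := Submodule.exists_forall_linearIndependent_mkQ_comp
    (Sum.elim (fun t => (U t).comap V.subtype) fun i => LinearMap.ker (π i))
    (by simp only [Fintype.card_sum, Fintype.card_fin]; omega) (R - r)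
    (by rintro (t | i); exacts [hU' t, hπ i])
  refine ⟨fun j => b j, fun j => (b j).2, fun t => ?_, fun i => ?_⟩
  · have hdisj := Submodule.range_ker_disjoint (hb (Sum.inl t))
    rw [Submodule.ker_mkQ, Sum.elim_inl] at hdisj
    have hspan : Submodule.span F (Set.range fun j => (b j : Fin s → Fin R → F)) =
        (Submodule.span F (Set.range b)).map V.subtype := by
      rw [Submodule.map_span, ← Set.range_comp]
      rfl
    rw [hspan, Submodule.map_inf_eq_map_inf_comap, hdisj.eq_bot, Submodule.map_bot]
  · have hdisj := Submodule.range_ker_disjoint (hb (Sum.inr i))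
    rw [Submodule.ker_mkQ, Sum.elim_inr] at hdisj
    exact (LinearIndependent.of_comp _ (hb (Sum.inr i))).map hdisj
end

section
/- Let (V, E, tail, head) be a finite directed acyclic multigraph (acyclicity witnessed by an injection ord : E → ℕ with ord(d) < ord(e) whenever head(d) = tail(e)), and let σ_1, …, σ_s ∈ V be distinct nodes. Let X_1, …, X_s and B be arbitrary (finite) sets and let (g_e)_{e∈E}, g_e : Π_i X_i → B, be a family of functions such that: for every edge e with tail(e) = σ_i, g_e(x) depends only on the coordinate x_i (i.e. g_e = θ_e ∘ (x ↦ x_i) for some θ_e); and for every edge e with tail(e) ∉ {σ_1, …, σ_s}, g_e(x) = θ_e((g_d(x))_{d ∈ In(tail(e))}) for some function θ_e, where In(v) = {d ∈ E : head(d) = v}. Let A, C ⊆ E be edge subsets such that for every i and every e ∈ A, every path from σ_i to e contains an edge of C. Then there exists a function h such that (g_e(x))_{e∈A} = h((g_c(x))_{c∈C}) for all x ∈ Π_i X_i. -/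
theorem IsPathToEdge.singleton {V E : Type} (tail head : E → V) (e : E) :
    IsPathToEdge tail head (tail e) [e] e :=
  ⟨⟨e, rfl, rfl⟩, List.isChain_singleton e, rfl⟩

theorem IsPathToEdge.concat {V E : Type} {tail head : E → V} {u : V} {p : List E} {d e : E}
    (hp : IsPathToEdge tail head u p d) (hde : head d = tail e) :
    IsPathToEdge tail head u (p ++ [e]) e := by
  obtain ⟨⟨a, ha, hau⟩, hchain, hlast⟩ := hp
  refine ⟨⟨a, by simp [ha], hau⟩, ?_, by simp⟩
  refine List.isChain_append.2 ⟨hchain, List.isChain_singleton e, ?_⟩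
  simpa [hlast] using hde

/-- The message on a single edge separated from all sources by `C` is a function of the
messages on `C`. -/
theorem exists_message_eq_of_separated {V E Ω B ι : Type} {tail head : E → V} {ord : E → ℕ}
    (hDAG : ∀ d e : E, head d = tail e → ord d < ord e) {σ : ι → V} {g : E → Ω → B}
    (hrelay : ∀ e : E, tail e ∉ Set.range σ →
      ∃ θ : ({d : E // head d = tail e} → B) → B, ∀ x, g e x = θ (fun d => g d.1 x))
    {C : Set E} (e : E)
    (hsep : ∀ i, ∀ p : List E, IsPathToEdge tail head (σ i) p e → ∃ c ∈ p, c ∈ C) :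
    ∃ φ : ({c : E // c ∈ C} → B) → B, ∀ x, g e x = φ (fun c => g c.1 x) := by
  induction hn : ord e using Nat.strong_induction_on generalizing e with
  | _ n ih =>
    subst hn
    by_cases heC : e ∈ C
    · exact ⟨fun m => m ⟨e, heC⟩, fun _ => rfl⟩
    have hsource : tail e ∉ Set.range σ := by
      rintro ⟨i, hi⟩
      obtain ⟨c, hc, hcC⟩ := hsep i [e] (hi ▸ IsPathToEdge.singleton tail head e)
      exact heC (List.mem_singleton.1 hc ▸ hcC)
    obtain ⟨θ, hθ⟩ := hrelay e hsource
    have hin (d : {d : E // head d = tail e}) :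
        ∃ φ : ({c : E // c ∈ C} → B) → B, ∀ x, g d.1 x = φ (fun c => g c.1 x) := by
      refine ih _ (hDAG d.1 e d.2) d.1 (fun i p hp => ?_) rfl
      obtain ⟨c, hc, hcC⟩ := hsep i _ (hp.concat d.2)
      rcases List.mem_append.1 hc with hc | hc
      · exact ⟨c, hc, hcC⟩
      · exact absurd (List.mem_singleton.1 hc ▸ hcC) heC
    choose φ hφ using hin
    exact ⟨fun m => θ fun d => φ d m, fun x => by simp only [hθ, hφ]⟩

/-- Mechanism of network coding: in a DAG, if the global encoding functions `g_e` are induced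
by local encoding functions (at sources `σ_i`, `g_e` depends only on the `i`-th input; at
non-source nodes, `g_e` is a function of the messages on the in-edges of `tail e`), and if
every path from any source to any edge of `A` contains an edge of `C`, then the messages on
`A` are a function of the messages on `C`. -/
theorem messages_determined_by_cut
    {V E : Type} [Fintype V] [Fintype E] (tail head : E → V)
    (ord : E → ℕ) (hord : Function.Injective ord)
    (hDAG : ∀ d e : E, head d = tail e → ord d < ord e)
    {s : ℕ} (σ : Fin s → V) (hσ : Function.Injective σ)
    (X : Fin s → Type) [∀ i, Fintype (X i)] {B : Type} [Fintype B]
    (g : E → ((i : Fin s) → X i) → B)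
    (hsrc : ∀ (e : E) (i : Fin s), tail e = σ i →
      ∃ θ : X i → B, ∀ x, g e x = θ (x i))
    (hrelay : ∀ e : E, tail e ∉ Set.range σ →
      ∃ θ : ({d : E // head d = tail e} → B) → B, ∀ x, g e x = θ (fun d => g d.1 x))
    (A C : Set E)
    (hsep : ∀ (i : Fin s), ∀ e ∈ A, ∀ p : List E,
      IsPathToEdge tail head (σ i) p e → ∃ c ∈ p, c ∈ C) :
    ∃ h : ({c : E // c ∈ C} → B) → ({e : E // e ∈ A} → B),
      ∀ x, (fun e : {e : E // e ∈ A} => g e.1 x) = h (fun c => g c.1 x) := by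
  choose φ hφ using fun e : {e : E // e ∈ A} =>
    exists_message_eq_of_separated hDAG hrelay e.1 fun i => hsep i e.1 e.2
  exact ⟨fun m e => φ e m, fun x => funext fun e => hφ e x⟩
end

section
/- Let F be a field, s ≥ 1 and 0 ≤ r ≤ R integers. Let B_1, …, B_s be invertible R × R matrices over F, let B̂ be the (Rs) × (Rs) block-diagonal matrix with diagonal blocks B_1, …, B_s, and let T be the (Rs) × (R−r) matrix obtained by stacking s copies of [I_{R−r} ; 0_{r × (R−r)}] vertically. For 1 ≤ j ≤ R, let b_j ∈ F^{Rs} be the vector whose i-th block b_j^{(i)} ∈ F^R is the j-th column of B_i^{-1} (so b_1, …, b_{R−r} are exactly the columns of B̂^{-1}·T). Let V ⊆ F^{Rs} be a subspace and let (U_t)_{t∈T'} be a family of subspaces of F^{Rs} containing the zero subspace. If ⟨B̂^{-1}·T⟩ ⊆ V and ⟨B̂^{-1}·T⟩ ∩ U_t = {0} for every t ∈ T', then for every 1 ≤ j ≤ R − r: b_j ∈ V; b_j ∉ U_t + span{b_1, …, b_{j−1}} for every t ∈ T'; and for each 1 ≤ i ≤ s, b_j^{(i)} ∉ span{b_1^{(i)},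 …, b_{j−1}^{(i)}}. -/
/-- If `W` is disjoint from `U`, a vector of `W` lying in `U ⊔ P` with `P ≤ W` lies in `P`. -/
theorem Submodule.mem_of_mem_sup_of_inf_eq_bot {K M : Type*} [Ring K] [AddCommGroup M]
    [Module K M] {W U P : Submodule K M} (h : W ⊓ U = ⊥) (hP : P ≤ W) {x : M} (hx : x ∈ W)
    (hxs : x ∈ U ⊔ P) : x ∈ P := by
  have hmod : (P ⊔ U) ⊓ W = P := by
    rw [sup_inf_assoc_of_le U hP, inf_comm, h, sup_bot_eq]
  exact hmod.le ⟨sup_comm U P ▸ hxs, hx⟩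

/-- Appendix B claim: let `B_1, …, B_s` be invertible `R × R` matrices, `B̂⁻¹` the
block-diagonal matrix with diagonal blocks `B_i⁻¹`, and `T` the `s`-fold vertical stack of
`[I_{R−r} ; 0_{r×(R−r)}]`. Let `b_j ∈ F^{Rs}` have `i`-th block the `j`-th column of
`B_i⁻¹` (so `b_1, …, b_{R−r}` are the columns of `B̂⁻¹·T`). If `⟨B̂⁻¹·T⟩ ⊆ V` and
`⟨B̂⁻¹·T⟩ ∩ U_t = {0}` for every `t` (the family `(U_t)` containing the zero subspace),
then for every `j` with `j ≤ R − r` (0-indexed: `(j : ℕ) < R − r`): `b_j ∈ V`;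
`b_j ∉ U_t + span{b_1, …, b_{j−1}}` for every `t`; and each block
`b_j^{(i)} ∉ span{b_1^{(i)}, …, b_{j−1}^{(i)}}`. -/
theorem blockDiagonal_transform_sequential
    {F : Type} [Field F] [DecidableEq F] (s R r : ℕ) (hs : 1 ≤ s) (hr : r ≤ R)
    (B Binv : Fin s → Matrix (Fin R) (Fin R) F)
    (hBinv : ∀ i, B i * Binv i = 1 ∧ Binv i * B i = 1)
    (BhatInv : Matrix (Fin s × Fin R) (Fin s × Fin R) F)
    (hBhatInv : ∀ p q : Fin s × Fin R,
      BhatInv p q = if p.1 = q.1 then Binv p.1 p.2 q.2 else 0)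
    (T : Matrix (Fin s × Fin R) (Fin (R - r)) F)
    (hT : ∀ p j, T p j = if (p.2 : ℕ) = (j : ℕ) then (1 : F) else 0)
    (b : Fin R → (Fin s × Fin R → F))
    (hb : ∀ (j : Fin R) (p : Fin s × Fin R), b j p = Binv p.1 p.2 j)
    (V : Submodule F (Fin s × Fin R → F))
    {ι : Type} (U : ι → Submodule F (Fin s × Fin R → F))
    (hzero : ∃ t, U t = ⊥)
    (hVsub : LinearMap.range (BhatInv * T).mulVecLin ≤ V)
    (hU : ∀ t, LinearMap.range (BhatInv * T).mulVecLin ⊓ U t = ⊥) :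
    ∀ j : Fin R, (j : ℕ) < R - r →
      b j ∈ V ∧
      (∀ t, b j ∉ U t ⊔ Submodule.span F (b '' {j' : Fin R | j' < j})) ∧
      (∀ i : Fin s,
        (fun a => b j (i, a)) ∉
          Submodule.span F ((fun j' => fun a => b j' (i, a)) '' {j' : Fin R | j' < j})) := by
  have hcol : ∀ j : Fin R, (j : ℕ) < R - r →
      b j ∈ LinearMap.range (BhatInv * T).mulVecLin := by
    intro j hj
    refine ⟨Pi.single ⟨j, hj⟩ 1, ?_⟩
    ext p
    simp [Matrix.mulVec, dotProduct, hBhatInv, hT, hb, Fintype.sum_prod_type, Fin.val_inj]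
  have hblock : ∀ (j : Fin R) (i : Fin s), (fun a => b j (i, a)) ∉
      Submodule.span F ((fun j' => fun a => b j' (i, a)) '' {j' : Fin R | j' < j}) := by
    intro j i
    have hli : LinearIndependent F (fun (j' : Fin R) (a : Fin R) => b j' (i, a)) := by
      simp only [hb]
      exact Matrix.linearIndependent_cols_iff_isUnit.2
        ⟨⟨Binv i, B i, (hBinv i).2, (hBinv i).1⟩, rfl⟩
    exact hli.notMem_span_image (by simp)
  intro j hj
  refine ⟨hVsub (hcol j hj), fun t ht => ?_, hblock j⟩
  have hle : Submodule.span F (b '' {j' : Fin R | j' < j}) ≤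
      LinearMap.range (BhatInv * T).mulVecLin := by
    rw [Submodule.span_le]
    rintro _ ⟨j', hj', rfl⟩
    exact hcol j' (lt_trans (Fin.lt_def.1 hj') hj)
  have hmem := Submodule.mem_of_mem_sup_of_inf_eq_bot (hU t) hle (hcol j hj) ht
  apply hblock j ⟨0, hs⟩
  have := Submodule.mem_map_of_mem
    (f := LinearMap.funLeft F F (fun a : Fin R => ((⟨0, hs⟩ : Fin s), a))) hmem
  rwa [Submodule.map_span, Set.image_image] at this
end
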